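/- Decay of the one-sided inverse covariance (Theorem 2.1, bound (2.2)). Fix constants K < ∞, κ > 1 and 0 < λ_inf ≤ λ_sup < ∞. Then there exists a constant 𝒦 < ∞, depending only on K, κ, λ_inf, λ_sup (in particular not on p), such that for every p ∈ ℕ, every operator 𝐂 satisfying Assumption A(p, K, κ, λ_inf, λ_sup), every T ∈ ℤ and all t, τ ≤ T, the blocks of the inverse of the one-sided compression satisfy ‖[𝐂(−∞,T)⁻¹]_{t,τ}‖₂ ≤ 𝒦 ζ(t−τ)^{κ−1}. -/

import Mathlib

noncomputable section

/-- `⟨x⟩ = max(1,|x|)` -/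
def gu (x : ℝ) : ℝ := max 1 |x|

/-- `ζ(x) = max(1, log⟨x⟩)/⟨x⟩` -/
def zeta (x : ℝ) : ℝ := max 1 (Real.log (gu x)) / gu x

/-- spectral norm of a matrix -/
def specNorm {𝕜 : Type*} [RCLike 𝕜] {m n : Type*} [Fintype m] [Fintype n] [DecidableEq n]
    (M : Matrix m n 𝕜) : ℝ :=
  ‖LinearMap.toContinuousLinearMap (Matrix.toEuclideanLin M)‖

/-- `ℓ²(ι; ℝ^p)` -/
abbrev HpI (ι : Type) (p : ℕ) : Type := lp (fun _ : ι => EuclideanSpace ℝ (Fin p)) 2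

abbrev Hp (p : ℕ) : Type := HpI ℤ p

/-- the sequence `δ_t ⊗ e_a` -/
def bvec {ι : Type} [DecidableEq ι] (p : ℕ) (t : ι) (a : Fin p) : HpI ι p :=
  lp.single 2 t (EuclideanSpace.single a 1)

/-- the `p × p` block `A_{t,τ}` of an operator -/
def blk {ι : Type} [DecidableEq ι] {p : ℕ} (A : HpI ι p →L[ℝ] HpI ι p) (t τ : ι) :
    Matrix (Fin p) (Fin p) ℝ :=
  Matrix.of fun a b => inner (𝕜 := ℝ) (bvec p t a) (A (bvec p τ b))

/-- Assumption A(p, K, κ, λ_inf, λ_sup): a bounded self-adjoint operator on `H_p` whose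
quadratic form is bounded between `λ_inf` and `λ_sup` and whose off-diagonal blocks decay
at the rate `K⟨t−τ⟩^{−κ}`. -/
structure AssumptionA (p : ℕ) (K κ lamInf lamSup : ℝ) (C : Hp p →L[ℝ] Hp p) : Prop where
  symm : ∀ x y : Hp p, inner (𝕜 := ℝ) (C x) y = inner (𝕜 := ℝ) x (C y)
  lower : ∀ v : Hp p, lamInf * ‖v‖ ^ 2 ≤ inner (𝕜 := ℝ) v (C v)
  upper : ∀ v : Hp p, inner (𝕜 := ℝ) v (C v) ≤ lamSup * ‖v‖ ^ 2
  decay : ∀ t τ : ℤ, t ≠ τ → specNorm (blk C t τ) ≤ K * gu ((t : ℝ) - (τ : ℝ)) ^ (-κ)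

/-- A symmetric operator whose quadratic form takes values in `[0, r]` on the unit ball has
norm at most `r`. -/
theorem norm_le_of_symm_of_quadratic_le {H : Type*} [NormedAddCommGroup H] [InnerProductSpace ℝ H]
    (B : H →L[ℝ] H) (hsymm : ∀ x y, inner ℝ (B x) y = inner ℝ x (B y)) {r : ℝ} (hr : 0 ≤ r)
    (hlow : ∀ x, 0 ≤ inner ℝ x (B x)) (hupp : ∀ x, inner ℝ x (B x) ≤ r * ‖x‖ ^ 2) : ‖B‖ ≤ r := by
  rw [B.norm_eq_iSup_rayleighQuotient hsymm]
  refine ciSup_le fun x => ?_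
  rw [ContinuousLinearMap.rayleighQuotient, ContinuousLinearMap.reApplyInnerSelf_apply,
    RCLike.re_to_real, hsymm, abs_of_nonneg (div_nonneg (hlow x) (sq_nonneg _))]
  exact div_le_of_le_mul₀ (sq_nonneg _) hr (hupp x)

theorem norm_clm_pow_le {H : Type*} [NormedAddCommGroup H] [NormedSpace ℝ H] (B : H →L[ℝ] H)
    {ρ : ℝ} (hB : ‖B‖ ≤ ρ) (n : ℕ) : ‖B ^ n‖ ≤ ρ ^ n := by
  have hρ : 0 ≤ ρ := (norm_nonneg B).trans hB
  induction n with
  | zero =>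
    rw [pow_zero, pow_zero]
    exact ContinuousLinearMap.norm_id_le
  | succ n ih =>
    rw [pow_succ, pow_succ]
    exact (norm_mul_le _ _).trans (by gcongr)

theorem norm_geom_sum_clm_le {H : Type*} [NormedAddCommGroup H] [NormedSpace ℝ H] (B : H →L[ℝ] H)
    {ρ : ℝ} (hρ : ρ < 1) (hB : ‖B‖ ≤ ρ) (n : ℕ) :
    ‖∑ k ∈ Finset.range n, B ^ k‖ ≤ (1 - ρ)⁻¹ := by
  have hρ0 : 0 ≤ ρ := (norm_nonneg B).trans hB
  calc _ ≤ ∑ k ∈ Finset.range n, ρ ^ k :=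
        norm_sum_le_of_le _ fun k _ => norm_clm_pow_le B hB k
    _ ≤ (1 - ρ)⁻¹ := by
        rw [← tsum_geometric_of_lt_one hρ0 hρ]
        exact (summable_geometric_of_lt_one hρ0 hρ).sum_le_tsum _ fun k _ => by positivity

section Coercive

variable {H : Type*} [NormedAddCommGroup H] [InnerProductSpace ℝ H] (A : H →L[ℝ] H) {l u : ℝ}

theorem norm_one_sub_inv_smul_le (hl : 0 < l) (hlu : l ≤ u)
    (hsymm : ∀ x y, inner ℝ (A x) y = inner ℝ x (A y))
    (hlow : ∀ x, l * ‖x‖ ^ 2 ≤ inner ℝ x (A x)) (hupp : ∀ x, inner ℝ x (A x) ≤ u * ‖x‖ ^ 2) :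
    ‖1 - u⁻¹ • A‖ ≤ 1 - l / u := by
  have hu : 0 < u := hl.trans_le hlu
  have key : ∀ x, inner ℝ x ((1 - u⁻¹ • A) x) = ‖x‖ ^ 2 - u⁻¹ * inner ℝ x (A x) := fun x => by
    simp [inner_sub_right, inner_smul_right]
  refine norm_le_of_symm_of_quadratic_le _ (fun x y => ?_) ?_ (fun x => ?_) fun x => ?_
  · simp [inner_sub_right, inner_smul_right, inner_sub_left, inner_smul_left, hsymm]
  · rw [sub_nonneg]; exact (div_le_one hu).2 hlu
  · rw [key, sub_nonneg, inv_mul_le_iff₀ hu]; exact hupp x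
  · rw [key, sub_mul, one_mul, div_eq_inv_mul, mul_assoc]
    gcongr
    exact hlow x

theorem exists_inverse_of_coercive [CompleteSpace H] (hl : 0 < l) (hlu : l ≤ u)
    (hsymm : ∀ x y, inner ℝ (A x) y = inner ℝ x (A y))
    (hlow : ∀ x, l * ‖x‖ ^ 2 ≤ inner ℝ x (A x)) (hupp : ∀ x, inner ℝ x (A x) ≤ u * ‖x‖ ^ 2) :
    ∃ D : H →L[ℝ] H, A * D = 1 ∧ D * A = 1 ∧ ‖D‖ ≤ l⁻¹ := by
  have hu : 0 < u := hl.trans_le hlu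
  have hB := norm_one_sub_inv_smul_le A hl hlu hsymm hlow hupp
  obtain ⟨U, hU⟩ := isUnit_one_sub_of_norm_lt_one
    (hB.trans_lt (sub_lt_self 1 (div_pos hl hu)))
  have hAU : A = u • (U : H →L[ℝ] H) := by rw [hU, sub_sub_cancel, smul_inv_smul₀ hu.ne']
  have hAD : A * (u⁻¹ • (U⁻¹ : (H →L[ℝ] H)ˣ).val) = 1 := by
    rw [hAU, smul_mul_smul_comm, mul_inv_cancel₀ hu.ne', Units.mul_inv, one_smul]
  refine ⟨u⁻¹ • (U⁻¹ : (H →L[ℝ] H)ˣ).val, hAD, ?_, ?_⟩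
  · rw [hAU, smul_mul_smul_comm, inv_mul_cancel₀ hu.ne', Units.inv_mul, one_smul]
  · generalize u⁻¹ • (U⁻¹ : (H →L[ℝ] H)ˣ).val = D at hAD
    refine D.opNorm_le_bound (inv_nonneg.2 hl.le) fun x => ?_
    rw [← div_eq_inv_mul, le_div_iff₀ hl]
    have h1 : A (D x) = x := DFunLike.congr_fun hAD x
    have h2 := hlow (D x)
    rw [h1] at h2
    have h3 := real_inner_le_norm (D x) x
    rcases (norm_nonneg (D x)).eq_or_lt with h | h
    · rw [← h]; simp
    · nlinarith

/-- Approximation of the inverse of `A` by a polynomial in the perturbation `A - F`. -/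
theorem norm_inverse_sub_geom_sum_le (hl : 0 < l) (hlu : l ≤ u)
    (hsymm : ∀ x y, inner ℝ (A x) y = inner ℝ x (A y))
    (hlow : ∀ x, l * ‖x‖ ^ 2 ≤ inner ℝ x (A x)) (hupp : ∀ x, inner ℝ x (A x) ≤ u * ‖x‖ ^ 2)
    {D F : H →L[ℝ] H} (hDA : D * A = 1) (hD : ‖D‖ ≤ l⁻¹) {ε : ℝ} (hF : ‖F‖ ≤ ε)
    (hε : ε ≤ l / 2) (d : ℕ) :
    ‖D - u⁻¹ • ∑ k ∈ Finset.range d, (1 - u⁻¹ • (A - F)) ^ k‖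
      ≤ l⁻¹ * ((1 - l / (2 * u)) ^ d + 2 * ε / l) := by
  have hu : 0 < u := hl.trans_le hlu
  have hε0 : 0 ≤ ε := (norm_nonneg F).trans hF
  set B := 1 - u⁻¹ • (A - F) with hBdef
  set P := ∑ k ∈ Finset.range d, B ^ k with hP
  have hB : ‖B‖ ≤ 1 - l / (2 * u) := by
    have h1 : B = (1 - u⁻¹ • A) + u⁻¹ • F := by rw [hBdef, smul_sub]; abel
    rw [h1]
    refine (norm_add_le _ _).trans ?_
    have h2 := norm_one_sub_inv_smul_le A hl hlu hsymm hlow hupp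
    have h3 : ‖u⁻¹ • F‖ ≤ u⁻¹ * (l / 2) := by
      rw [norm_smul, Real.norm_of_nonneg (inv_nonneg.2 hu.le)]
      gcongr
      exact hF.trans hε
    have h4 : l / (2 * u) = l / u - u⁻¹ * (l / 2) := by field_simp; ring
    linarith
  have hPn : ‖P‖ ≤ 2 * u / l := by
    have := norm_geom_sum_clm_le B (sub_lt_self 1 (by positivity)) hB d
    rwa [sub_sub_cancel, inv_div] at this
  have hAP : (u⁻¹ • (A - F)) * P = 1 - B ^ d := by
    rw [← mul_neg_geom_sum, hBdef, sub_sub_cancel]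
  have hid : D - u⁻¹ • P = D * (B ^ d - u⁻¹ • (F * P)) := by
    have h5 : B ^ d = 1 - (u⁻¹ • (A - F)) * P := by rw [hAP, sub_sub_cancel]
    rw [h5, smul_mul_assoc, sub_mul, smul_sub, mul_sub, mul_sub, mul_sub, mul_one,
      mul_smul_comm, ← mul_assoc D A, hDA, one_mul]
    abel
  rw [hid]
  have h6 : ‖u⁻¹ • (F * P)‖ ≤ 2 * ε / l := by
    rw [norm_smul, Real.norm_of_nonneg (inv_nonneg.2 hu.le)]
    calc u⁻¹ * ‖F * P‖ ≤ u⁻¹ * (ε * (2 * u / l)) := by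
          gcongr
          exact (norm_mul_le _ _).trans (by gcongr)
      _ = 2 * ε / l := by field_simp
  refine (norm_mul_le _ _).trans ?_
  gcongr
  refine (norm_sub_le _ _).trans (add_le_add (norm_clm_pow_le B hB d) h6)

end Coercive

theorem sum_norm_sq_le_lp {ι V : Type*} [NormedAddCommGroup V] (x : lp (fun _ : ι => V) 2)
    (s : Finset ι) : ∑ t ∈ s, ‖x t‖ ^ 2 ≤ ‖x‖ ^ 2 := by
  have := lp.sum_rpow_le_norm_rpow (p := 2) (by norm_num) x s
  simpa using this

section Schur

variable {ι V : Type*} [NormedAddCommGroup V] [InnerProductSpace ℝ V]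

theorem sum_kernel_le {M : ι → ι → V →L[ℝ] V} {S : ℝ}
    (hrow : ∀ t (s : Finset ι), ∑ τ ∈ s, ‖M t τ‖ ≤ S)
    (hcol : ∀ τ (s : Finset ι), ∑ t ∈ s, ‖M t τ‖ ≤ S)
    (x y : lp (fun _ : ι => V) 2) (G : Finset (ι × ι)) :
    ∑ q ∈ G, ‖inner ℝ (y q.1) (M q.1 q.2 (x q.2))‖ ≤ S * ‖x‖ * ‖y‖ := by
  classical
  rcases isEmpty_or_nonempty ι with hι | ⟨⟨t₀⟩⟩
  · have : G = ∅ := Finset.eq_empty_of_isEmpty G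
    have hx : x = 0 := by ext i; exact isEmptyElim i
    simp [this, hx]
  have hS : 0 ≤ S := by simpa using hrow t₀ ∅
  set s := G.image Prod.fst
  set r := G.image Prod.snd
  have hsub : G ⊆ s ×ˢ r := fun q hq =>
    Finset.mem_product.2 ⟨Finset.mem_image_of_mem _ hq, Finset.mem_image_of_mem _ hq⟩
  have hy : ∑ q ∈ s ×ˢ r, ‖M q.1 q.2‖ * ‖y q.1‖ ^ 2 ≤ S * ‖y‖ ^ 2 := by
    rw [Finset.sum_product]
    calc _ ≤ ∑ t ∈ s, S * ‖y t‖ ^ 2 := Finset.sum_le_sum fun t _ => by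
          dsimp only; rw [← Finset.sum_mul]; gcongr; exact hrow t r
      _ ≤ _ := by rw [← Finset.mul_sum]; gcongr; exact sum_norm_sq_le_lp y s
  have hx : ∑ q ∈ s ×ˢ r, ‖M q.1 q.2‖ * ‖x q.2‖ ^ 2 ≤ S * ‖x‖ ^ 2 := by
    rw [Finset.sum_product_right]
    calc _ ≤ ∑ t ∈ r, S * ‖x t‖ ^ 2 := Finset.sum_le_sum fun t _ => by
          dsimp only; rw [← Finset.sum_mul]; gcongr; exact hcol t s
      _ ≤ _ := by rw [← Finset.mul_sum]; gcongr; exact sum_norm_sq_le_lp x r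
  have hmain : ∑ q ∈ s ×ˢ r, (√‖M q.1 q.2‖ * ‖y q.1‖) * (√‖M q.1 q.2‖ * ‖x q.2‖)
      ≤ S * ‖x‖ * ‖y‖ := by
    refine abs_le_of_sq_le_sq' ?_ (by positivity) |>.2
    refine (Finset.sum_mul_sq_le_sq_mul_sq _ _ _).trans ?_
    simp only [mul_pow, Real.sq_sqrt (norm_nonneg _)]
    calc _ ≤ (S * ‖y‖ ^ 2) * (S * ‖x‖ ^ 2) := by gcongr
      _ = S ^ 2 * ‖x‖ ^ 2 * ‖y‖ ^ 2 := by ring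
  refine le_trans ?_ hmain
  refine (Finset.sum_le_sum_of_subset_of_nonneg hsub fun _ _ _ => norm_nonneg _).trans
    (Finset.sum_le_sum fun q _ => ?_)
  calc _ ≤ ‖y q.1‖ * (‖M q.1 q.2‖ * ‖x q.2‖) :=
        (norm_inner_le_norm _ _).trans (by gcongr; exact (M q.1 q.2).le_opNorm _)
    _ = (√‖M q.1 q.2‖ * √‖M q.1 q.2‖) * ‖y q.1‖ * ‖x q.2‖ := by
        rw [Real.mul_self_sqrt (norm_nonneg _)]; ring
    _ = _ := by ring

/-- Schur test: a kernel of operators with uniformly summable rows and columns defines a bounded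
operator on `ℓ²`. -/
theorem exists_clm_of_kernel [CompleteSpace V] [DecidableEq ι] {M : ι → ι → V →L[ℝ] V} {S : ℝ}
    (hS : 0 ≤ S)
    (hrow : ∀ t (s : Finset ι), ∑ τ ∈ s, ‖M t τ‖ ≤ S)
    (hcol : ∀ τ (s : Finset ι), ∑ t ∈ s, ‖M t τ‖ ≤ S) :
    ∃ F : lp (fun _ : ι => V) 2 →L[ℝ] lp (fun _ : ι => V) 2, ‖F‖ ≤ S ∧
      ∀ t τ v, F (lp.single 2 τ v) t = M t τ v := by
  set f : lp (fun _ : ι => V) 2 → lp (fun _ : ι => V) 2 → ι × ι → ℝ :=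
    fun x y q => inner ℝ (y q.1) (M q.1 q.2 (x q.2)) with hf
  have hsum : ∀ x y, Summable fun q => ‖f x y q‖ := fun x y =>
    summable_of_sum_le (fun _ => norm_nonneg _) (sum_kernel_le hrow hcol x y)
  have hbound : ∀ x y, ‖∑' q, f x y q‖ ≤ S * ‖x‖ * ‖y‖ := fun x y =>
    (norm_tsum_le_tsum_norm (hsum x y)).trans
      ((hsum x y).tsum_le_of_sum_le (sum_kernel_le hrow hcol x y))
  let b : lp (fun _ : ι => V) 2 →ₗ[ℝ] lp (fun _ : ι => V) 2 →ₗ[ℝ] ℝ :=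
    LinearMap.mk₂ ℝ (fun x y => ∑' q, f x y q)
      (fun x x' y => by
        rw [← (hsum x y).of_norm.tsum_add (hsum x' y).of_norm]
        simp [hf, inner_add_right])
      (fun c x y => by
        rw [smul_eq_mul, ← tsum_mul_left]
        simp [hf, inner_smul_right])
      (fun x y y' => by
        rw [← (hsum x y).of_norm.tsum_add (hsum x y').of_norm]
        simp [hf, inner_add_left])
      (fun c x y => by
        rw [smul_eq_mul, ← tsum_mul_left]
        simp [hf, inner_smul_left])
  let B := b.mkContinuous₂ S hbound
  let L : lp (fun _ : ι => V) 2 →ₗ[ℝ] lp (fun _ : ι => V) 2 :=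
    { toFun := fun x => (InnerProductSpace.toDual ℝ _).symm (B x)
      map_add' := fun x y => by simp
      map_smul' := fun c x => by simp }
  have hL : ∀ x y : lp (fun _ : ι => V) 2, inner ℝ (L x) y = ∑' q, f x y q := fun x y =>
    InnerProductSpace.toDual_symm_apply
  have hLn : ∀ x, ‖L x‖ ≤ S * ‖x‖ := fun x =>
    ((InnerProductSpace.toDual ℝ (lp (fun _ : ι => V) 2)).symm.norm_map _).trans_le
      (B.le_of_opNorm_le (b.mkContinuous₂_norm_le hS hbound) x)
  refine ⟨L.mkContinuous S hLn, LinearMap.mkContinuous_norm_le _ hS _, fun t τ v => ?_⟩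
  refine ext_inner_right ℝ fun w => ?_
  rw [← lp.inner_single_right (𝕜 := ℝ) (G := fun _ => V) t w, LinearMap.mkContinuous_apply, hL,
    tsum_eq_single (t, τ)]
  · simp only [hf, lp.single_apply_self, real_inner_comm]
  · rintro ⟨i, j⟩ hij
    by_cases hi : i = t
    · have hj : j ≠ τ := fun hj => hij (by rw [hi, hj])
      simp only [hf, lp.single_apply_ne _ _ _ hj, map_zero, inner_zero_right]
    · simp only [hf, lp.single_apply_ne _ _ _ hi, inner_zero_left]

end Schur

section Banded

variable {ι V : Type*} [NormedAddCommGroup V] [InnerProductSpace ℝ V]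

/-- `X` enlarges supports by at most `w`, where the indices are placed on `ℤ` by `pos`. -/
def IsBanded (pos : ι → ℤ) (w : ℕ) (X : lp (fun _ : ι => V) 2 →L[ℝ] lp (fun _ : ι => V) 2) :
    Prop :=
  ∀ (c : ℤ) (a : ℕ) (x : lp (fun _ : ι => V) 2), (∀ s, a < (pos s - c).natAbs → x s = 0) →
    ∀ t, a + w < (pos t - c).natAbs → X x t = 0

variable {pos : ι → ℤ} {w w' : ℕ} {X Y : lp (fun _ : ι => V) 2 →L[ℝ] lp (fun _ : ι => V) 2}

theorem IsBanded.mono (hX : IsBanded pos w X) (h : w ≤ w') : IsBanded pos w' X :=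
  fun c a x hx t ht => hX c a x hx t (by omega)

theorem IsBanded.one : IsBanded pos 0 (1 : lp (fun _ : ι => V) 2 →L[ℝ] lp (fun _ : ι => V) 2) :=
  fun _ _ _ hx t ht => hx t ht

theorem IsBanded.mul (hX : IsBanded pos w X) (hY : IsBanded pos w' Y) :
    IsBanded pos (w' + w) (X * Y) :=
  fun c a x hx t ht => hX c (a + w') (Y x) (hY c a x hx) t (by omega)

theorem IsBanded.pow (hX : IsBanded pos w X) (n : ℕ) : IsBanded pos (n * w) (X ^ n) := by
  induction n with
  | zero => simpa using IsBanded.one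
  | succ n ih =>
    rw [pow_succ', Nat.succ_mul]
    exact hX.mul ih

theorem IsBanded.smul (hX : IsBanded pos w X) (r : ℝ) : IsBanded pos w (r • X) :=
  fun c a x hx t ht => by
    rw [smul_apply, lp.coeFn_smul, Pi.smul_apply, hX c a x hx t ht, smul_zero]

theorem IsBanded.sum {α : Type*} {s : Finset α}
    {Z : α → lp (fun _ : ι => V) 2 →L[ℝ] lp (fun _ : ι => V) 2}
    (hZ : ∀ k ∈ s, IsBanded pos w (Z k)) : IsBanded pos w (∑ k ∈ s, Z k) :=
  fun c a x hx t ht => by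
    rw [sum_apply, lp.coeFn_sum, Finset.sum_apply]
    exact Finset.sum_eq_zero fun k hk => hZ k hk c a x hx t ht

theorem hasSum_apply_single [DecidableEq ι]
    (X : lp (fun _ : ι => V) 2 →L[ℝ] lp (fun _ : ι => V) 2) (x : lp (fun _ : ι => V) 2) :
    HasSum (fun s => X (lp.single 2 s (x s))) (X x) :=
  X.hasSum (lp.hasSum_single (by norm_num) x)

theorem isBanded_of_single [DecidableEq ι]
    (h : ∀ t τ v, w < (pos t - pos τ).natAbs → X (lp.single 2 τ v) t = 0) : IsBanded pos w X := by
  intro c a x hx t ht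
  refine ext_inner_left ℝ fun u => ?_
  rw [← lp.inner_single_left (𝕜 := ℝ) (G := fun _ => V) t u, inner_zero_right]
  refine ((hasSum_apply_single X x).mapL (innerSL ℝ (lp.single 2 t u))).unique ?_
  convert hasSum_zero with s
  rw [innerSL_apply_apply, lp.inner_single_left]
  by_cases hs : a < (pos s - c).natAbs
  · rw [hx s hs, lp.single_zero, map_zero, lp.coeFn_zero, Pi.zero_apply, inner_zero_right]
  · rw [h t s _ (by omega), inner_zero_right]

theorem IsBanded.apply_single [DecidableEq ι] (hX : IsBanded pos w X) {t τ : ι} (v : V)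
    (h : w < (pos t - pos τ).natAbs) : X (lp.single 2 τ v) t = 0 :=
  hX (pos τ) 0 _ (fun s hs => lp.single_apply_ne _ _ _ (by rintro rfl; simp at hs)) t (by omega)

end Banded

section Block

variable {ι V : Type*} [NormedAddCommGroup V] [InnerProductSpace ℝ V] [DecidableEq ι]

theorem clm_ext_single {X Y : lp (fun _ : ι => V) 2 →L[ℝ] lp (fun _ : ι => V) 2}
    (h : ∀ t τ v, X (lp.single 2 τ v) t = Y (lp.single 2 τ v) t) : X = Y := by
  ext1 x
  refine (hasSum_apply_single X x).unique ?_
  convert hasSum_apply_single Y x using 2 with s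
  exact lp.ext (funext fun t => h t s _)

theorem norm_apply_single_le (X : lp (fun _ : ι => V) 2 →L[ℝ] lp (fun _ : ι => V) 2) (t τ : ι)
    (v : V) : ‖X (lp.single 2 τ v) t‖ ≤ ‖X‖ * ‖v‖ :=
  (lp.norm_apply_le_norm (by norm_num) _ t).trans
    ((X.le_opNorm _).trans_eq (by rw [lp.norm_single (by norm_num)]))

/-- The block of `X` at position `(t, τ)`, as an operator on the fibre. -/
def blockCLM (X : lp (fun _ : ι => V) 2 →L[ℝ] lp (fun _ : ι => V) 2) (t τ : ι) : V →L[ℝ] V :=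
  LinearMap.mkContinuous
    { toFun := fun v => X (lp.single 2 τ v) t
      map_add' := fun v w => by rw [lp.single_add, map_add, lp.coeFn_add, Pi.add_apply]
      map_smul' := fun c v => by
        rw [lp.single_smul, map_smul, lp.coeFn_smul, Pi.smul_apply, RingHom.id_apply] }
    ‖X‖ (norm_apply_single_le X t τ)

theorem blockCLM_apply (X : lp (fun _ : ι => V) 2 →L[ℝ] lp (fun _ : ι => V) 2) (t τ : ι) (v : V) :
    blockCLM X t τ v = X (lp.single 2 τ v) t := rfl

theorem norm_blockCLM_le (X : lp (fun _ : ι => V) 2 →L[ℝ] lp (fun _ : ι => V) 2) (t τ : ι) :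
    ‖blockCLM X t τ‖ ≤ ‖X‖ :=
  ContinuousLinearMap.opNorm_le_bound _ X.opNorm_nonneg (norm_apply_single_le X t τ)

end Block

theorem toContinuousLinearMap_blk {ι : Type} [DecidableEq ι] {p : ℕ}
    (X : HpI ι p →L[ℝ] HpI ι p) (t τ : ι) :
    LinearMap.toContinuousLinearMap (Matrix.toEuclideanLin (blk X t τ)) = blockCLM X t τ := by
  refine ContinuousLinearMap.coe_injective
    ((EuclideanSpace.basisFun (Fin p) ℝ).toBasis.ext fun b => ?_)
  ext a
  simp [Matrix.toEuclideanLin, Matrix.toLpLin_apply, blk, bvec, blockCLM_apply,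
    lp.inner_single_left, EuclideanSpace.inner_single_left]

theorem specNorm_blk {ι : Type} [DecidableEq ι] {p : ℕ} (X : HpI ι p →L[ℝ] HpI ι p) (t τ : ι) :
    specNorm (blk X t τ) = ‖blockCLM X t τ‖ := by
  rw [specNorm, toContinuousLinearMap_blk]

section Inclusion

variable {ι V : Type*} [NormedAddCommGroup V] [InnerProductSpace ℝ V] [DecidableEq ι]

/-- `lp.single` as a linear isometry into `ℓ²`. -/
def singleIsometry (i : ι) : V →ₗᵢ[ℝ] lp (fun _ : ι => V) 2 where
  toLinearMap := lp.lsingle (E := fun _ : ι => V) 2 i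
  norm_map' v := lp.norm_single (E := fun _ : ι => V) (by norm_num) i v

theorem orthogonalFamily_single (S : ι → Prop) :
    OrthogonalFamily ℝ (fun _ : {i // S i} => V) fun i =>
      singleIsometry (V := V) i.1 := by
  intro i j hij v w
  refine (lp.inner_single_left (𝕜 := ℝ) (G := fun _ : ι => V) i.1 v _).trans ?_
  have h : lp.single (E := fun _ : ι => V) 2 j.1 w i.1 = 0 :=
    lp.single_apply_ne _ _ _ fun h => hij (Subtype.ext h)
  exact (congrArg _ h).trans (inner_zero_right _)

/-- Quadratic forms of the compression of `C` to a subset of the indices are values of the form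
of `C`. -/
theorem exists_isometry_inner_compression [CompleteSpace V] {S : ι → Prop}
    (C : lp (fun _ : ι => V) 2 →L[ℝ] lp (fun _ : ι => V) 2)
    (A : lp (fun _ : {i // S i} => V) 2 →L[ℝ] lp (fun _ : {i // S i} => V) 2)
    (h : ∀ t τ, blockCLM A t τ = blockCLM C t.1 τ.1) :
    ∃ J : lp (fun _ : {i // S i} => V) 2 →ₗᵢ[ℝ] lp (fun _ : ι => V) 2,
      ∀ x y, inner ℝ x (A y) = inner ℝ (J x) (C (J y)) := by
  set J := (orthogonalFamily_single (V := V) S).linearIsometry with hJ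
  have hJs : ∀ τ v, J (lp.single 2 τ v) = lp.single 2 τ.1 v := fun τ v =>
    (orthogonalFamily_single S).linearIsometry_apply_single v
  set Jc := J.toContinuousLinearMap
  have hA : A = (ContinuousLinearMap.adjoint Jc).comp (C.comp Jc) := by
    refine clm_ext_single fun t τ v => ext_inner_left ℝ fun w => ?_
    rw [← lp.inner_single_left (𝕜 := ℝ) (G := fun _ => V) t w,
      ← lp.inner_single_left (𝕜 := ℝ) (G := fun _ => V) t w, ContinuousLinearMap.comp_apply,
      ContinuousLinearMap.adjoint_inner_right, ContinuousLinearMap.comp_apply]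
    change _ = inner ℝ (J _) (C (J _))
    rw [hJs, hJs, lp.inner_single_left, lp.inner_single_left, ← blockCLM_apply, h,
      blockCLM_apply]
  refine ⟨J, fun x y => ?_⟩
  rw [hA, ContinuousLinearMap.comp_apply, ContinuousLinearMap.adjoint_inner_right]
  rfl

end Inclusion

theorem mul_rpow_succ_le_sub {s x : ℝ} (hx : 1 ≤ x) (hs : 0 < s) :
    s * (x + 1) ^ (-(s + 1)) ≤ x ^ (-s) - (x + 1) ^ (-s) := by
  have hx0 : 0 < x := by linarith
  have hx1 : 0 < x + 1 := by linarith
  have h1 : 1 + s / (x + 1) ≤ (x / (x + 1)) ^ (-s) := by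
    rw [Real.rpow_def_of_pos (by positivity)]
    have h2 := Real.log_le_sub_one_of_pos (show 0 < x / (x + 1) by positivity)
    have h3 : x / (x + 1) - 1 = -(1 / (x + 1)) := by field_simp; ring
    have h4 := Real.add_one_le_exp (Real.log (x / (x + 1)) * -s)
    have h5 : s / (x + 1) = s * (1 / (x + 1)) := by ring
    nlinarith
  have h6 : x ^ (-s) = (x / (x + 1)) ^ (-s) * (x + 1) ^ (-s) := by
    rw [← Real.mul_rpow (by positivity) hx1.le, div_mul_cancel₀ _ hx1.ne']
  have h7 : (x + 1) ^ (-(s + 1)) = (x + 1) ^ (-s) / (x + 1) := by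
    rw [neg_add, Real.rpow_add hx1, Real.rpow_neg_one, div_eq_mul_inv]
  have h8 := mul_le_mul_of_nonneg_right h1 (Real.rpow_nonneg hx1.le (-s))
  rw [h6, h7]
  calc _ = (1 + s / (x + 1)) * (x + 1) ^ (-s) - (x + 1) ^ (-s) := by ring
    _ ≤ _ := by linarith

theorem sum_nat_rpow_tail_le {κ : ℝ} (hκ : 1 < κ) (m : ℕ) (s : Finset ℕ) (hs : ∀ j ∈ s, m < j) :
    ∑ j ∈ s, (j : ℝ) ^ (-κ) ≤ 2 ^ κ / (κ - 1) * ((m : ℝ) + 1) ^ (-(κ - 1)) := by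
  have hκ' : 0 < κ - 1 := sub_pos.2 hκ
  set N := max (m + 1) (s.sup id + 1)
  have hsub : s ⊆ Finset.Ico (m + 1) N := fun j hj => by
    have : j ≤ s.sup id := Finset.le_sup (f := id) hj
    have := hs j hj
    simp only [Finset.mem_Ico, N, lt_max_iff]
    omega
  have hterm : ∀ j ∈ Finset.Ico (m + 1) N, (j : ℝ) ^ (-κ) ≤
      2 ^ κ / (κ - 1) * ((j : ℝ) ^ (-(κ - 1)) - ((j + 1 : ℕ) : ℝ) ^ (-(κ - 1))) := fun j hj => by
    have hj1 : (1 : ℝ) ≤ j := by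
      have := (Finset.mem_Ico.1 hj).1
      exact_mod_cast (show 1 ≤ j by omega)
    have h1 := mul_rpow_succ_le_sub hj1 hκ'
    rw [sub_add_cancel] at h1
    have h2 : (j : ℝ) ^ (-κ) ≤ 2 ^ κ * ((j : ℝ) + 1) ^ (-κ) := by
      have h3 : (2 * (j : ℝ)) ^ (-κ) ≤ ((j : ℝ) + 1) ^ (-κ) :=
        Real.rpow_le_rpow_of_nonpos (by positivity) (by linarith) (by linarith)
      rw [Real.mul_rpow (by norm_num) (by positivity), Real.rpow_neg (by norm_num),
        inv_mul_le_iff₀ (by positivity)] at h3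
      exact h3
    push_cast
    calc _ ≤ 2 ^ κ * ((j : ℝ) + 1) ^ (-κ) := h2
      _ = 2 ^ κ / (κ - 1) * ((κ - 1) * ((j : ℝ) + 1) ^ (-κ)) := by field_simp
      _ ≤ _ := by gcongr
  calc _ ≤ ∑ j ∈ Finset.Ico (m + 1) N, (j : ℝ) ^ (-κ) :=
        Finset.sum_le_sum_of_subset_of_nonneg hsub fun _ _ _ => by positivity
    _ ≤ _ := Finset.sum_le_sum hterm
    _ ≤ _ := by
        have h := Finset.sum_Ico_sub (fun j : ℕ => -(j : ℝ) ^ (-(κ - 1)))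
          (le_max_left (m + 1) (s.sup id + 1))
        simp only [neg_sub_neg] at h
        rw [← Finset.mul_sum, h]
        gcongr
        push_cast
        exact sub_le_self _ (by positivity)

theorem gu_intCast {j : ℤ} (hj : j ≠ 0) : gu (j : ℝ) = j.natAbs := by
  rw [gu, Nat.cast_natAbs, Int.cast_abs, max_eq_right]
  exact_mod_cast Int.one_le_abs hj

theorem sum_int_rpow_tail_le {κ : ℝ} (hκ : 1 < κ) (m : ℕ) (s : Finset ℤ)
    (hs : ∀ j ∈ s, m < j.natAbs) :
    ∑ j ∈ s, gu (j : ℝ) ^ (-κ) ≤ 2 * (2 ^ κ / (κ - 1) * ((m : ℝ) + 1) ^ (-(κ - 1))) := by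
  have hpart : ∀ r ⊆ s, Set.InjOn Int.natAbs (r : Set ℤ) →
      ∑ j ∈ r, gu (j : ℝ) ^ (-κ) ≤ 2 ^ κ / (κ - 1) * ((m : ℝ) + 1) ^ (-(κ - 1)) := by
    intro r hr hinj
    refine le_trans (le_of_eq ?_)
      (sum_nat_rpow_tail_le hκ m (r.image Int.natAbs) fun j hj => ?_)
    · rw [Finset.sum_image hinj]
      refine Finset.sum_congr rfl fun j hj => ?_
      have := hs j (hr hj)
      rw [gu_intCast (by omega)]
    · obtain ⟨i, hi, rfl⟩ := Finset.mem_image.1 hj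
      exact hs i (hr hi)
  rw [← Finset.sum_filter_add_sum_filter_not s (fun j => 0 < j), two_mul]
  refine add_le_add (hpart _ (Finset.filter_subset _ _) ?_) (hpart _ (Finset.filter_subset _ _) ?_)
  · intro i hi j hj hij
    simp only [Finset.coe_filter, Set.mem_ofPred_eq] at hi hj
    omega
  · intro i hi j hj hij
    simp only [Finset.coe_filter, Set.mem_ofPred_eq] at hi hj
    omega

section Truncation

variable {ι V : Type*} [NormedAddCommGroup V] [InnerProductSpace ℝ V] [DecidableEq ι]

/-- An operator with polynomially decaying blocks is banded up to an error of small norm. -/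
theorem exists_isBanded_sub [CompleteSpace V] {pos : ι → ℤ} (hpos : pos.Injective)
    (A : lp (fun _ : ι => V) 2 →L[ℝ] lp (fun _ : ι => V) 2) {K κ : ℝ} (hK : 0 ≤ K) (hκ : 1 < κ)
    (hA : ∀ t τ, t ≠ τ → ‖blockCLM A t τ‖ ≤ K * gu ((pos t : ℝ) - (pos τ : ℝ)) ^ (-κ)) (m : ℕ) :
    ∃ F : lp (fun _ : ι => V) 2 →L[ℝ] lp (fun _ : ι => V) 2,
      ‖F‖ ≤ K * (2 * (2 ^ κ / (κ - 1))) * ((m : ℝ) + 1) ^ (-(κ - 1)) ∧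
        IsBanded pos m (A - F) := by
  have hκ' : 0 < κ - 1 := sub_pos.2 hκ
  set M : ι → ι → V →L[ℝ] V :=
    fun t τ => if m < (pos t - pos τ).natAbs then blockCLM A t τ else 0 with hM
  have hsum : ∀ (a b : ι → ι) (s : Finset ι),
      Set.InjOn (fun i => pos (a i) - pos (b i)) (s : Set ι) →
      ∑ i ∈ s, ‖M (a i) (b i)‖
        ≤ K * (2 * (2 ^ κ / (κ - 1))) * ((m : ℝ) + 1) ^ (-(κ - 1)) := by
    intro a b s hinj
    set r := s.filter fun i => m < (pos (a i) - pos (b i)).natAbs with hr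
    have hrs : r ⊆ s := Finset.filter_subset _ _
    have h1 : ∑ i ∈ s, ‖M (a i) (b i)‖ = ∑ i ∈ r, ‖blockCLM A (a i) (b i)‖ := by
      rw [hr, Finset.sum_filter]
      refine Finset.sum_congr rfl fun i _ => ?_
      simp only [hM]
      split_ifs <;> simp
    have hmem : ∀ i ∈ r, m < (pos (a i) - pos (b i)).natAbs := fun i hi =>
      (Finset.mem_filter.1 hi).2
    have h2 : ∀ i ∈ r, ‖blockCLM A (a i) (b i)‖
        ≤ K * gu (((pos (a i) - pos (b i) : ℤ)) : ℝ) ^ (-κ) := fun i hi => by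
      have := hmem i hi
      rw [Int.cast_sub]
      exact hA _ _ fun h => by simp [h] at this
    have h3 := sum_int_rpow_tail_le hκ m (r.image fun i => pos (a i) - pos (b i)) fun j hj => by
      obtain ⟨i, hi, rfl⟩ := Finset.mem_image.1 hj
      exact hmem i hi
    rw [Finset.sum_image (hinj.mono (Finset.coe_subset.2 hrs))] at h3
    calc _ ≤ ∑ i ∈ r, K * gu (((pos (a i) - pos (b i) : ℤ)) : ℝ) ^ (-κ) :=
          h1.trans_le (Finset.sum_le_sum h2)
      _ ≤ K * (2 * (2 ^ κ / (κ - 1) * ((m : ℝ) + 1) ^ (-(κ - 1)))) := by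
          rw [← Finset.mul_sum]; gcongr
      _ = _ := by ring
  obtain ⟨F, hF, hFM⟩ := exists_clm_of_kernel (M := M) (by positivity)
    (fun t s => hsum (fun _ => t) id s fun i _ j _ h => hpos (sub_right_injective h))
    (fun τ s => hsum id (fun _ => τ) s fun i _ j _ h => hpos (sub_left_injective h))
  refine ⟨F, hF, isBanded_of_single fun t τ v h => ?_⟩
  rw [sub_apply, lp.coeFn_sub, Pi.sub_apply, hFM]
  simp only [hM, if_pos h, blockCLM_apply, sub_self]

/-- Off-diagonal decay of the blocks of the inverse, with a free choice of the bandwidth `m` and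
of the degree `d` of the approximating polynomial. -/
theorem norm_blockCLM_inverse_le [CompleteSpace V] {pos : ι → ℤ} (hpos : pos.Injective)
    (A : lp (fun _ : ι => V) 2 →L[ℝ] lp (fun _ : ι => V) 2) {K κ l u : ℝ} (hK : 0 ≤ K)
    (hκ : 1 < κ) (hl : 0 < l) (hlu : l ≤ u)
    (hsymm : ∀ x y, inner ℝ (A x) y = inner ℝ x (A y))
    (hlow : ∀ x, l * ‖x‖ ^ 2 ≤ inner ℝ x (A x)) (hupp : ∀ x, inner ℝ x (A x) ≤ u * ‖x‖ ^ 2)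
    (hA : ∀ t τ, t ≠ τ → ‖blockCLM A t τ‖ ≤ K * gu ((pos t : ℝ) - (pos τ : ℝ)) ^ (-κ))
    {D : lp (fun _ : ι => V) 2 →L[ℝ] lp (fun _ : ι => V) 2} (hDA : D * A = 1) (hD : ‖D‖ ≤ l⁻¹)
    {t τ : ι} {m d : ℕ} (hmd : d * m < (pos t - pos τ).natAbs) :
    ‖blockCLM D t τ‖ ≤ l⁻¹ * ((1 - l / (2 * u)) ^ d +
      2 * (K * (2 * (2 ^ κ / (κ - 1)))) / l * ((m : ℝ) + 1) ^ (-(κ - 1))) := by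
  have hu : 0 < u := hl.trans_le hlu
  have hκ' : 0 < κ - 1 := sub_pos.2 hκ
  obtain ⟨F, hF, hband⟩ := exists_isBanded_sub hpos A hK hκ hA m
  set ε := K * (2 * (2 ^ κ / (κ - 1))) * ((m : ℝ) + 1) ^ (-(κ - 1)) with hε
  have hεl : 2 * (K * (2 * (2 ^ κ / (κ - 1)))) / l * ((m : ℝ) + 1) ^ (-(κ - 1)) = 2 * ε / l := by
    rw [hε]; ring
  rw [hεl]
  have hρ : 0 ≤ 1 - l / (2 * u) := by
    rw [sub_nonneg, div_le_one (by positivity)]; linarith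
  rcases le_or_gt ε (l / 2) with h | h
  · set P := u⁻¹ • ∑ k ∈ Finset.range d, (1 - u⁻¹ • (A - F)) ^ k with hP
    have hB : IsBanded pos m (1 - u⁻¹ • (A - F)) := by
      have h1 := (hband.smul u⁻¹)
      refine isBanded_of_single fun t τ v ht => ?_
      rw [sub_apply, lp.coeFn_sub, Pi.sub_apply, h1.apply_single v ht,
        (IsBanded.one.mono (Nat.zero_le m)).apply_single v ht, sub_zero]
    have hPb : IsBanded pos (d * m) P := (IsBanded.sum fun k hk =>
      (hB.pow k).mono (Nat.mul_le_mul_right m (Finset.mem_range.1 hk).le)).smul _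
    have hblk : blockCLM D t τ = blockCLM (D - P) t τ := by
      ext v
      rw [blockCLM_apply, blockCLM_apply, sub_apply, lp.coeFn_sub, Pi.sub_apply,
        hPb.apply_single v hmd, sub_zero]
    rw [hblk]
    exact (norm_blockCLM_le _ _ _).trans
      (norm_inverse_sub_geom_sum_le A hl hlu hsymm hlow hupp hDA hD hF h d)
  · refine (norm_blockCLM_le _ _ _).trans (hD.trans (le_mul_of_one_le_right (by positivity) ?_))
    have h1 : 1 ≤ 2 * ε / l := by rw [le_div_iff₀ hl]; linarith
    have h2 := pow_nonneg hρ d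
    linarith

end Truncation

theorem exists_degree_bandwidth {κ ρ c : ℝ} (hκ : 1 < κ) (hρ : 0 < ρ) (hρ1 : ρ < 1) (hc : 0 ≤ c) :
    ∃ K' : ℝ, 1 ≤ K' ∧ ∀ n : ℕ, 1 ≤ n → ∃ d m : ℕ, d * m < n ∧
      ρ ^ d + c * ((m : ℝ) + 1) ^ (-(κ - 1)) ≤ K' * (max 1 (Real.log n) / n) ^ (κ - 1) := by
  have hκ' : 0 < κ - 1 := sub_pos.2 hκ
  have hlog : Real.log ρ < 0 := Real.log_neg hρ hρ1
  set a := (κ - 1) / (-Real.log ρ) with ha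
  have ha0 : 0 < a := div_pos hκ' (neg_pos.2 hlog)
  refine ⟨1 + c * (a + 1) ^ (κ - 1), le_add_of_nonneg_right (by positivity), fun n hn => ?_⟩
  have hn0 : (0 : ℝ) < n := by exact_mod_cast hn
  set L := max 1 (Real.log n) with hL
  have hL1 : 1 ≤ L := le_max_left _ _
  have hL0 : 0 < L := by linarith
  set d := ⌈a * L⌉₊ with hd
  have hd0 : 0 < d := Nat.ceil_pos.2 (by positivity)
  have hdL : a * L ≤ d := Nat.le_ceil _
  have hdu : (d : ℝ) ≤ (a + 1) * L := by
    have := (Nat.ceil_lt_add_one (show 0 ≤ a * L by positivity)).le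
    linarith
  refine ⟨d, (n - 1) / d, ?_, ?_⟩
  · have := Nat.mul_div_le (n - 1) d
    omega
  have hm : (n : ℝ) ≤ d * (((n - 1) / d : ℕ) + 1) := by
    have := Nat.lt_mul_div_succ (n - 1) hd0
    exact_mod_cast (show n ≤ d * ((n - 1) / d + 1) by omega)
  have h1 : ρ ^ d ≤ (L / n) ^ (κ - 1) := by
    have h2 : ρ ^ d ≤ (n : ℝ) ^ (-(κ - 1)) := by
      rw [← Real.rpow_natCast, Real.rpow_def_of_pos hρ, Real.rpow_def_of_pos hn0,
        Real.exp_le_exp]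
      have h3 : Real.log n ≤ L := le_max_right _ _
      have h4 : a * -Real.log ρ = κ - 1 := div_mul_cancel₀ _ (neg_pos.2 hlog).ne'
      nlinarith
    refine h2.trans ?_
    rw [Real.rpow_neg hn0.le, ← Real.inv_rpow hn0.le, inv_eq_one_div]
    gcongr
  have h5 : (((n - 1) / d : ℕ) + 1 : ℝ) ^ (-(κ - 1))
      ≤ (a + 1) ^ (κ - 1) * (L / n) ^ (κ - 1) := by
    rw [Real.rpow_neg (by positivity), ← Real.inv_rpow (by positivity),
      ← Real.mul_rpow (by positivity) (by positivity)]
    refine Real.rpow_le_rpow (by positivity) ?_ hκ'.le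
    rw [inv_le_iff_one_le_mul₀ (by positivity), ← mul_div_assoc, div_mul_eq_mul_div,
      le_div_iff₀ hn0, one_mul]
    exact hm.trans (by gcongr)
  rw [add_mul, one_mul, mul_assoc]
  gcongr

/-- Theorem 2.1, bound (2.2): decay of the blocks of the inverse of the one-sided
compression `𝐂(−∞,T)`.  The compression is characterised as the (unique) bounded operator
on `ℓ²({t ≤ T}; ℝ^p)` whose blocks agree with those of `𝐂`. -/
theorem one_sided_inverse_covariance_decay (K κ lamInf lamSup : ℝ)
    (hκ : 1 < κ) (hInf : 0 < lamInf) (hle : lamInf ≤ lamSup) :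
    ∃ 𝒦 : ℝ, 0 < 𝒦 ∧
      ∀ (p : ℕ), 1 ≤ p → ∀ (C : Hp p →L[ℝ] Hp p), AssumptionA p K κ lamInf lamSup C →
        ∀ (T : ℤ) (CT : HpI {t : ℤ // t ≤ T} p →L[ℝ] HpI {t : ℤ // t ≤ T} p),
          (∀ t τ : {t : ℤ // t ≤ T}, blk CT t τ = blk C (t : ℤ) (τ : ℤ)) →
          ∃ DT : HpI {t : ℤ // t ≤ T} p →L[ℝ] HpI {t : ℤ // t ≤ T} p,
            CT.comp DT = ContinuousLinearMap.id ℝ _ ∧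
            DT.comp CT = ContinuousLinearMap.id ℝ _ ∧
            ∀ t τ : {t : ℤ // t ≤ T},
              specNorm (blk DT t τ) ≤ 𝒦 * zeta (((t : ℤ) : ℝ) - ((τ : ℤ) : ℝ)) ^ (κ - 1) := by
  obtain ⟨K', hK', hdeg⟩ := exists_degree_bandwidth (ρ := 1 - lamInf / (2 * lamSup))
    (c := 2 * (max K 0 * (2 * (2 ^ κ / (κ - 1)))) / lamInf) hκ
    (by
      have hSup : 0 < lamSup := hInf.trans_le hle
      rw [sub_pos, div_lt_one (by positivity)]; linarith)
    (sub_lt_self 1 (div_pos hInf (by linarith)))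
    (by
      have hκ' : 0 < κ - 1 := sub_pos.2 hκ
      positivity)
  refine ⟨lamInf⁻¹ * K', by positivity, fun p _ C hC T CT hCT => ?_⟩
  have hblk : ∀ t τ, blockCLM CT t τ = blockCLM C t.1 τ.1 := fun t τ => by
    rw [← toContinuousLinearMap_blk, ← toContinuousLinearMap_blk, hCT]
  obtain ⟨J, hJ⟩ := exists_isometry_inner_compression C CT hblk
  have hlow : ∀ x, lamInf * ‖x‖ ^ 2 ≤ inner ℝ x (CT x) := fun x => by
    rw [hJ, ← J.norm_map]; exact hC.lower _
  have hupp : ∀ x, inner ℝ x (CT x) ≤ lamSup * ‖x‖ ^ 2 := fun x => by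
    rw [hJ, ← J.norm_map]; exact hC.upper _
  have hsymm : ∀ x y, inner ℝ (CT x) y = inner ℝ x (CT y) := fun x y => by
    rw [real_inner_comm, hJ, hJ, ← hC.symm, real_inner_comm]
  have hdecay : ∀ t τ, t ≠ τ →
      ‖blockCLM CT t τ‖ ≤ max K 0 * gu (((t : ℤ) : ℝ) - ((τ : ℤ) : ℝ)) ^ (-κ) := fun t τ h => by
    rw [hblk, ← specNorm_blk]
    refine (hC.decay t τ fun h' => h (Subtype.ext h')).trans ?_
    have hgu : 0 ≤ gu (((t : ℤ) : ℝ) - ((τ : ℤ) : ℝ)) := zero_le_one.trans (le_max_left _ _)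
    gcongr
    exact le_max_left _ _
  obtain ⟨D, hAD, hDA, hD⟩ := exists_inverse_of_coercive CT hInf hle hsymm hlow hupp
  refine ⟨D, hAD, hDA, fun t τ => ?_⟩
  rw [specNorm_blk, mul_assoc]
  by_cases h : t = τ
  · subst h
    have hz : zeta (((t : ℤ) : ℝ) - ((t : ℤ) : ℝ)) = 1 := by simp [zeta, gu]
    rw [hz, Real.one_rpow, mul_one]
    exact (norm_blockCLM_le _ _ _).trans (hD.trans (le_mul_of_one_le_right (by positivity) hK'))
  · have hne : (t : ℤ) - τ ≠ 0 := sub_ne_zero.2 fun h' => h (Subtype.ext h')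
    obtain ⟨d, m, hdm, hbound⟩ := hdeg ((t : ℤ) - τ).natAbs (by omega)
    rw [zeta, ← Int.cast_sub, gu_intCast hne]
    exact (norm_blockCLM_inverse_le (pos := Subtype.val) Subtype.val_injective CT
      (le_max_right K 0) hκ hInf hle hsymm hlow hupp hdecay hDA hD hdm).trans (by gcongr)
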